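/- arXiv:2107.09896 — 7 statements merged into one kernel-verified Lean document; each statement's English description precedes it below -/
import Mathlib

section
/- For constants a > 0 and b > 0, the function Z1(x,y) = x·ln(1 + a·y/(y + b·x)) is jointly concave in (x,y) on the domain {(x,y) : x > 0, y > 0}. -/
/-- The function `(x, y) ↦ x * y / (y + b * x)` is superadditive on the positive quadrant. -/
theorem mul_div_add_mul_superadditive {b x y u v : ℝ} (hb : 0 < b) (hx : 0 < x) (hy : 0 < y)
    (hu : 0 < u) (hv : 0 < v) :
    x * (y / (y + b * x)) + u * (v / (v + b * u)) ≤
      (x + u) * ((y + v) / (y + v + b * (x + u))) := by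
  have key : (x + u) * ((y + v) / (y + v + b * (x + u))) -
      (x * (y / (y + b * x)) + u * (v / (v + b * u))) =
      b * (x * v - u * y) ^ 2 /
        ((y + b * x) * (v + b * u) * (y + v + b * (x + u))) := by
    field_simp
    ring
  have : 0 ≤ b * (x * v - u * y) ^ 2 /
      ((y + b * x) * (v + b * u) * (y + v + b * (x + u))) := by positivity
  linarith

/-- The function `(x, y) ↦ x * log (1 + a * y / (y + b * x))` is superadditive on the positive
quadrant. -/
theorem mul_log_superadditive {a b x y u v : ℝ} (ha : 0 < a) (hb : 0 < b) (hx : 0 < x)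
    (hy : 0 < y) (hu : 0 < u) (hv : 0 < v) :
    x * Real.log (1 + a * y / (y + b * x)) + u * Real.log (1 + a * v / (v + b * u)) ≤
      (x + u) * Real.log (1 + a * (y + v) / (y + v + b * (x + u))) := by
  have hxu : 0 < x + u := by positivity
  have hP : 0 < 1 + a * y / (y + b * x) := by positivity
  have hQ : 0 < 1 + a * v / (v + b * u) := by positivity
  have hlog := strictConcaveOn_log_Ioi.concaveOn.2 (Set.mem_Ioi.2 hP) (Set.mem_Ioi.2 hQ)
    (div_pos hx hxu).le (div_pos hu hxu).le (by field_simp)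
  simp only [smul_eq_mul] at hlog
  have hle : x / (x + u) * (1 + a * y / (y + b * x)) + u / (x + u) * (1 + a * v / (v + b * u)) ≤
      1 + a * (y + v) / (y + v + b * (x + u)) := by
    have h := mul_le_mul_of_nonneg_left (mul_div_add_mul_superadditive hb hx hy hu hv) ha.le
    rw [div_mul_eq_mul_div, div_mul_eq_mul_div, ← add_div, div_le_iff₀ hxu]
    simp only [mul_div_assoc]
    linarith
  have h := hlog.trans (Real.log_le_log (by positivity) hle)
  rw [div_mul_eq_mul_div, div_mul_eq_mul_div, ← add_div, div_le_iff₀ hxu] at h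
  linarith

/-- For constants `a > 0` and `b > 0`, the function
`Z1(x,y) = x * ln (1 + a*y/(y + b*x))` is jointly concave on `{(x,y) | x > 0, y > 0}`. -/
theorem Z1_concaveOn (a b : ℝ) (ha : 0 < a) (hb : 0 < b) :
    ConcaveOn ℝ {p : ℝ × ℝ | 0 < p.1 ∧ 0 < p.2}
      (fun p : ℝ × ℝ => p.1 * Real.log (1 + a * p.2 / (p.2 + b * p.1))) := by
  have homog : ∀ c x y : ℝ, 0 < c →
      a * (c * y) / (c * y + b * (c * x)) = a * y / (y + b * x) := by
    intro c x y hc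
    rw [← mul_div_mul_left (a * y) (y + b * x) hc.ne']
    congr 1 <;> ring
  rw [concaveOn_iff_forall_pos]
  constructor
  · exact (convex_Ioi (0 : ℝ)).prod (convex_Ioi (0 : ℝ))
  · rintro ⟨x, y⟩ ⟨hx, hy⟩ ⟨u, v⟩ ⟨hu, hv⟩ s t hs ht -
    have h := mul_log_superadditive ha hb (mul_pos hs hx) (mul_pos hs hy) (mul_pos ht hu)
      (mul_pos ht hv)
    rw [homog s x y hs, homog t u v ht] at h
    simpa only [smul_eq_mul, Prod.smul_mk, Prod.mk_add_mk, mul_assoc] using h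
end

section
/- For constants a, b, c, d > 0 satisfying a·d ≥ b·c, the function f2(x) = ln(1 + (a·x + b)/(c·x + d)) is concave on the domain x ≥ 0. -/
theorem concaveOn_one_add_div_affine {a b c d : ℝ} (hc : 0 < c) (hd : 0 < d)
    (h : b * c ≤ a * d) :
    ConcaveOn ℝ (Set.Ici (0 : ℝ)) (fun x : ℝ => 1 + (a * x + b) / (c * x + d)) := by
  refine ⟨convex_Ici 0, fun x hx y hy s t hs ht hst => ?_⟩
  simp only [Set.mem_Ici] at hx hy
  have hform : ∀ z : ℝ, 0 ≤ z →
      1 + (a * z + b) / (c * z + d) = 1 + a / c - (a * d - b * c) / c * (c * z + d)⁻¹ := by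
    intro z hz
    have hz' : 0 < c * z + d := by positivity
    field_simp
    ring
  have hinv := (convexOn_zpow (𝕜 := ℝ) (-1)).2
    (show c * x + d ∈ Set.Ioi 0 from by simp only [Set.mem_Ioi]; positivity)
    (show c * y + d ∈ Set.Ioi 0 from by simp only [Set.mem_Ioi]; positivity) hs ht hst
  simp only [smul_eq_mul, zpow_neg_one] at hinv ⊢
  rw [hform x hx, hform y hy, hform (s * x + t * y) (by positivity)]
  have haff : c * (s * x + t * y) + d = s * (c * x + d) + t * (c * y + d) := by
    linear_combination -d * hst
  have hk : 0 ≤ (a * d - b * c) / c := div_nonneg (sub_nonneg.2 h) hc.le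
  rw [haff]
  linear_combination (a * d - b * c) / c * hinv + (1 + a / c) * hst

/-- For constants `a, b, c, d > 0` with `a*d ≥ b*c`, the function
`f2(x) = ln (1 + (a*x + b)/(c*x + d))` is concave on `x ≥ 0`. -/
theorem f2_concaveOn (a b c d : ℝ) (ha : 0 < a) (hb : 0 < b) (hc : 0 < c) (hd : 0 < d)
    (habcd : a * d ≥ b * c) :
    ConcaveOn ℝ (Set.Ici (0 : ℝ))
      (fun x : ℝ => Real.log (1 + (a * x + b) / (c * x + d))) := by
  have hpos : ∀ z : ℝ, 0 ≤ z → 0 < 1 + (a * z + b) / (c * z + d) := fun z hz => by positivity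
  refine ⟨convex_Ici 0, fun x hx y hy s t hs ht hst => ?_⟩
  have hlog := strictConcaveOn_log_Ioi.concaveOn
  have hx' := hpos x hx
  have hy' := hpos y hy
  exact (hlog.2 hx' hy' hs ht hst).trans <| Real.log_le_log
    (hlog.1 hx' hy' hs ht hst)
    ((concaveOn_one_add_div_affine hc hd habcd).2 hx hy hs ht hst)
end

section
/- For constants a, b, c, d > 0 with a·d ≥ b·c and any x, x0 ≥ 0, the tangent line of f2(x) = ln(1 + (a·x + b)/(c·x + d)) at x0 is a global over-estimator: ln(1 + (a·x + b)/(c·x + d)) ≤ ln(1 + (a·x0 + b)/(c·x0 + d)) + (a·d − b·c)·(x − x0) / ((c·x0 + d)·(b + d + (a + c)·x0)). -/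
/-- For constants `a, b, c, d > 0` with `a*d ≥ b*c` and any `x, x0 ≥ 0`, the tangent line
of `f2(x) = ln (1 + (a*x + b)/(c*x + d))` at `x0` is a global over-estimator. -/
theorem f2_taylor_upper_bound (a b c d x x0 : ℝ) (ha : 0 < a) (hb : 0 < b) (hc : 0 < c)
    (hd : 0 < d) (habcd : a * d ≥ b * c) (hx : 0 ≤ x) (hx0 : 0 ≤ x0) :
    Real.log (1 + (a * x + b) / (c * x + d)) ≤
      Real.log (1 + (a * x0 + b) / (c * x0 + d))
      + (a * d - b * c) * (x - x0) / ((c * x0 + d) * (b + d + (a + c) * x0)) := by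
  have hQ : 0 < c * x + d := by positivity
  have hQ0 : 0 < c * x0 + d := by positivity
  have hP0 : 0 < b + d + (a + c) * x0 := by positivity
  have hu : 0 < 1 + (a * x + b) / (c * x + d) := by positivity
  have hv : 0 < 1 + (a * x0 + b) / (c * x0 + d) := by positivity
  have hlog := Real.log_le_sub_one_of_pos (div_pos hu hv)
  rw [Real.log_div hu.ne' hv.ne'] at hlog
  have hratio : (1 + (a * x + b) / (c * x + d)) / (1 + (a * x0 + b) / (c * x0 + d)) - 1 =
      (a * d - b * c) * (x - x0) / ((c * x + d) * (b + d + (a + c) * x0)) := by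
    have hv_eq : 1 + (a * x0 + b) / (c * x0 + d) = (b + d + (a + c) * x0) / (c * x0 + d) := by
      field_simp
      ring
    rw [hv_eq]
    field_simp
    ring
  have hgap : (a * d - b * c) * (x - x0) / ((c * x0 + d) * (b + d + (a + c) * x0)) -
      (a * d - b * c) * (x - x0) / ((c * x + d) * (b + d + (a + c) * x0)) =
      (a * d - b * c) * c * (x - x0) ^ 2 /
        ((c * x + d) * (c * x0 + d) * (b + d + (a + c) * x0)) := by
    field_simp
    ring
  have hD : 0 ≤ a * d - b * c := sub_nonneg.mpr habcd
  have hgap_nonneg : 0 ≤ (a * d - b * c) * c * (x - x0) ^ 2 /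
      ((c * x + d) * (c * x0 + d) * (b + d + (a + c) * x0)) := by
    positivity
  linarith
end

section
/- For constants a, b > 0 and any x, y, x0, y0 > 0, the first-order Taylor expansion of f41(x,y) = ln(1 + 1/(a·x + b·y)) at (x0,y0) is a global under-estimator: ln(1 + 1/(a·x + b·y)) ≥ ln(1 + 1/(a·x0 + b·y0)) − a·(x − x0)/((a·x0 + b·y0)·(a·x0 + b·y0 + 1)) − b·(y − y0)/((a·x0 + b·y0)·(a·x0 + b·y0 + 1)). -/
/-- The function `t ↦ log (1 + 1 / t)` lies above each of its tangent lines on `(0, ∞)`. -/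
theorem log_one_add_one_div_tangent_le {s t : ℝ} (hs : 0 < s) (ht : 0 < t) :
    Real.log (1 + 1 / s) - (t - s) / (s * (s + 1)) ≤ Real.log (1 + 1 / t) := by
  have hlog := Real.one_sub_inv_le_log_of_pos
    (show 0 < (1 + 1 / t) / (1 + 1 / s) by positivity)
  rw [Real.log_div (by positivity) (by positivity)] at hlog
  have hgap : 1 - ((1 + 1 / t) / (1 + 1 / s))⁻¹ + (t - s) / (s * (s + 1))
      = (s - t) ^ 2 / (s * (t + 1) * (s + 1)) := by
    field_simp
    ring
  have hnonneg : 0 ≤ (s - t) ^ 2 / (s * (t + 1) * (s + 1)) := by positivity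
  linarith

/-- For constants `a, b > 0` and any `x, y, x0, y0 > 0`, the first-order Taylor expansion
of `f41(x,y) = ln (1 + 1/(a*x + b*y))` at `(x0, y0)` is a global under-estimator. -/
theorem f41_taylor_lower_bound (a b x y x0 y0 : ℝ) (ha : 0 < a) (hb : 0 < b)
    (hx : 0 < x) (hy : 0 < y) (hx0 : 0 < x0) (hy0 : 0 < y0) :
    Real.log (1 + 1 / (a * x + b * y)) ≥
      Real.log (1 + 1 / (a * x0 + b * y0))
      - a * (x - x0) / ((a * x0 + b * y0) * (a * x0 + b * y0 + 1))
      - b * (y - y0) / ((a * x0 + b * y0) * (a * x0 + b * y0 + 1)) := by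
  have h := log_one_add_one_div_tangent_le
    (show 0 < a * x0 + b * y0 by positivity) (show 0 < a * x + b * y by positivity)
  rw [ge_iff_le, sub_sub, ← add_div]
  convert h using 3
  ring
end

section
/- For constants c, d > 0 and any x, y, x0, y0 > 0, the first-order Taylor expansion of f42(x,y) = ln(1 + c/x + d/y) at (x0,y0) is a global under-estimator: ln(1 + c/x + d/y) ≥ ln(1 + c/x0 + d/y0) − c·y0·(x − x0)/(x0·(c·y0 + d·x0 + x0·y0)) − d·x0·(y − y0)/(y0·(c·y0 + d·x0 + x0·y0)). -/
/-- Cauchy–Schwarz for the weights `1, a, b` and the points `1, u, v`. -/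
theorem sq_one_add_add_le_mul {a b u v : ℝ} (ha : 0 ≤ a) (hb : 0 ≤ b) (hu : 0 < u) (hv : 0 < v) :
    (1 + a + b) ^ 2 ≤ (1 + a * u + b * v) * (1 + a / u + b / v) := by
  have h : (1 + a * u + b * v) * (1 + a / u + b / v) - (1 + a + b) ^ 2 =
      a * (u - 1) ^ 2 / u + b * (v - 1) ^ 2 / v + a * b * (u - v) ^ 2 / (u * v) := by
    field_simp
    ring
  have : 0 ≤ a * (u - 1) ^ 2 / u + b * (v - 1) ^ 2 / v + a * b * (u - v) ^ 2 / (u * v) := by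
    positivity
  linarith

/-- Tangent plane bound for `(u, v) ↦ log (1 + a / u + b / v)` at `(1, 1)`. -/
theorem log_one_add_div_add_div_ge {a b u v : ℝ} (ha : 0 ≤ a) (hb : 0 ≤ b)
    (hu : 0 < u) (hv : 0 < v) :
    Real.log (1 + a + b) - (a * (u - 1) + b * (v - 1)) / (1 + a + b) ≤
      Real.log (1 + a / u + b / v) := by
  have hS : 0 < 1 + a / u + b / v := by positivity
  have hS₀ : 0 < 1 + a + b := by positivity
  have hlog := Real.one_sub_inv_le_log_of_pos (div_pos hS hS₀)
  rw [Real.log_div hS.ne' hS₀.ne', inv_div] at hlog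
  have hdiv : (1 + a + b) / (1 + a / u + b / v) ≤ (1 + a * u + b * v) / (1 + a + b) := by
    rw [div_le_div_iff₀ hS hS₀, ← sq]
    exact sq_one_add_add_le_mul ha hb hu hv
  have hsplit : (1 + a * u + b * v) / (1 + a + b) =
      1 + (a * (u - 1) + b * (v - 1)) / (1 + a + b) := by
    field_simp
    ring
  linarith


/-- For constants `c, d > 0` and any `x, y, x0, y0 > 0`, the first-order Taylor expansion
of `f42(x,y) = ln (1 + c/x + d/y)` at `(x0, y0)` is a global under-estimator. -/
theorem f42_taylor_lower_bound (c d x y x0 y0 : ℝ) (hc : 0 < c) (hd : 0 < d)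
    (hx : 0 < x) (hy : 0 < y) (hx0 : 0 < x0) (hy0 : 0 < y0) :
    Real.log (1 + c / x + d / y) ≥
      Real.log (1 + c / x0 + d / y0)
      - c * y0 * (x - x0) / (x0 * (c * y0 + d * x0 + x0 * y0))
      - d * x0 * (y - y0) / (y0 * (c * y0 + d * x0 + x0 * y0)) := by
  have h := log_one_add_div_add_div_ge (div_pos hc hx0).le (div_pos hd hy0).le
    (div_pos hx hx0) (div_pos hy hy0)
  rw [div_div_div_cancel_right₀ hx0.ne', div_div_div_cancel_right₀ hy0.ne'] at h
  have hslope : (c / x0 * (x / x0 - 1) + d / y0 * (y / y0 - 1)) / (1 + c / x0 + d / y0) =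
      c * y0 * (x - x0) / (x0 * (c * y0 + d * x0 + x0 * y0)) +
        d * x0 * (y - y0) / (y0 * (c * y0 + d * x0 + x0 * y0)) := by
    have hS : 1 + c / x0 + d / y0 = (c * y0 + d * x0 + x0 * y0) / (x0 * y0) := by
      field_simp
      ring
    have hD : c * y0 + d * x0 + x0 * y0 ≠ 0 := by positivity
    rw [hS]
    field_simp
  linarith
end

section
/- For a constant p > 0 and any x, x0 ≥ 0, the tangent line of f43(x) = x²·exp(p·x) at x0 is a global under-estimator: x²·exp(p·x) ≥ x0²·exp(p·x0) + x0·exp(p·x0)·(p·x0 + 2)·(x − x0). -/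
/-- For a constant `p > 0` and any `x, x0 ≥ 0`, the tangent line of
`f43(x) = x^2 * exp (p*x)` at `x0` is a global under-estimator. -/
theorem f43_taylor_lower_bound (p x x0 : ℝ) (hp : 0 < p) (hx : 0 ≤ x) (hx0 : 0 ≤ x0) :
    x ^ 2 * Real.exp (p * x) ≥
      x0 ^ 2 * Real.exp (p * x0) + x0 * Real.exp (p * x0) * (p * x0 + 2) * (x - x0) := by
  have hexp : Real.exp (p * x0) * (1 + p * (x - x0)) ≤ Real.exp (p * x) := by
    calc Real.exp (p * x0) * (1 + p * (x - x0))
        ≤ Real.exp (p * x0) * Real.exp (p * (x - x0)) := by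
          gcongr
          linarith [Real.add_one_le_exp (p * (x - x0))]
      _ = Real.exp (p * x) := by
          rw [← Real.exp_add]
          congr 1
          ring
  have hrem : 0 ≤ Real.exp (p * x0) * ((x - x0) ^ 2 * (1 + p * (x + x0))) := by positivity
  calc x0 ^ 2 * Real.exp (p * x0) + x0 * Real.exp (p * x0) * (p * x0 + 2) * (x - x0)
      ≤ x ^ 2 * (Real.exp (p * x0) * (1 + p * (x - x0))) := by linarith
    _ ≤ x ^ 2 * Real.exp (p * x) := by gcongr
end

section
/- For all constants a, b > 0 and all x, y > 0, the function Z1(x,y) = x·ln(1 + a·y/(y + b·x)) admits the relative-entropy decomposition: x·ln(1 + a·y/(y + b·x)) = −((1 + a)/(a·b))·E_rel(y + b·x, (a + 1)·y + b·x) − (1/(a·b))·E_rel((a + 1)·y + b·x, y + b·x), where E_rel(u,v) = u·ln(u/v) is the relative entropy function. -/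
/-- The relative entropy function `E_rel(u,v) = u * ln (u/v)`. -/
noncomputable def Erel (u v : ℝ) : ℝ := u * Real.log (u / v)

/-- For all constants `a, b > 0` and all `x, y > 0`, the function
`Z1(x,y) = x * ln (1 + a*y/(y + b*x))` admits the relative-entropy decomposition. -/
theorem Z1_relative_entropy_decomposition (a b x y : ℝ) (ha : 0 < a) (hb : 0 < b)
    (hx : 0 < x) (hy : 0 < y) :
    x * Real.log (1 + a * y / (y + b * x)) =
      -((1 + a) / (a * b)) * Erel (y + b * x) ((a + 1) * y + b * x)
      - (1 / (a * b)) * Erel ((a + 1) * y + b * x) (y + b * x) := by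
  have hp : 0 < y + b * x := by positivity
  have hq : 0 < (a + 1) * y + b * x := by positivity
  have hratio : 1 + a * y / (y + b * x) = ((a + 1) * y + b * x) / (y + b * x) := by
    field_simp
    ring
  rw [hratio, Erel, Erel, Real.log_div hq.ne' hp.ne', Real.log_div hp.ne' hq.ne']
  field_simp
  ring
end
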